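/- For every integer r ≥ 2 and every real p ≥ r, there exists N such that for all n ≥ N: ((r−1)/((p+1)e)) · n^{p+1} ≤ ((r−1)/(p+1)) · (p/(p+1))^p · n^{p+1} ≤ φ(r,p,n) ≤ (r/p) · (p/(p+1))^{p+1} · n^{p+1} ≤ (r/(pe)) · n^{p+1}. -/

import Mathlib

open Finset

/-- `f(p,G)`: the sum of the `p`-th powers of the vertex degrees of `G`. -/
noncomputable def degPowerSum (p : ℝ) {V : Type*} [Fintype V] (G : SimpleGraph V) : ℝ :=
  letI := Classical.decRel G.Adj
  ∑ u, (G.degree u : ℝ) ^ p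

/-- `φ(r,p,n)`: the maximum of `f(p,G)` over `K_{r+1}`-free graphs on `n` vertices. -/
noncomputable def phiClique (r : ℕ) (p : ℝ) (n : ℕ) : ℝ :=
  sSup {x | ∃ G : SimpleGraph (Fin n), G.CliqueFree (r + 1) ∧ x = degPowerSum p G}

theorem mul_sub_rpow_le {p x m : ℝ} (hp : 0 < p) (hx : 0 ≤ x) (hxm : x ≤ m) :
    x * (m - x) ^ p ≤ 1 / p * (p / (p + 1)) ^ (p + 1) * m ^ (p + 1) := by
  have hp1 : 0 < p + 1 := by linarith
  have hm : 0 ≤ m := hx.trans hxm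
  have hmx : 0 ≤ m - x := by linarith
  have amgm := Real.geom_mean_le_arith_mean2_weighted (w₁ := 1 / (p + 1)) (w₂ := p / (p + 1))
    (p₁ := x * p) (p₂ := m - x) (by positivity) (by positivity) (by positivity) hmx
    (by field_simp; ring)
  have hrhs : 1 / (p + 1) * (x * p) + p / (p + 1) * (m - x) = p / (p + 1) * m := by
    field_simp; ring
  rw [hrhs] at amgm
  have hpow := Real.rpow_le_rpow (by positivity) amgm hp1.le
  rw [Real.mul_rpow (by positivity) (by positivity), Real.mul_rpow (by positivity) hm,
    ← Real.rpow_mul (by positivity), ← Real.rpow_mul hmx, div_mul_cancel₀ _ hp1.ne',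
    div_mul_cancel₀ _ hp1.ne', Real.rpow_one] at hpow
  calc x * (m - x) ^ p = 1 / p * (x * p * (m - x) ^ p) := by field_simp
    _ ≤ 1 / p * ((p / (p + 1)) ^ (p + 1) * m ^ (p + 1)) := by gcongr
    _ = _ := by ring

theorem exp_neg_one_le_div_add_one_rpow {p : ℝ} (hp : 0 < p) :
    (Real.exp 1)⁻¹ ≤ (p / (p + 1)) ^ p := by
  have h : 0 < p / (p + 1) := by positivity
  rw [← Real.exp_neg, Real.rpow_def_of_pos h, Real.exp_le_exp]
  have := Real.one_sub_inv_le_log_of_pos h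
  have h2 : 1 - (p / (p + 1))⁻¹ = -1 / p := by field_simp; ring
  rw [h2, div_le_iff₀ hp] at this
  exact this

theorem div_add_one_rpow_add_one_le {p : ℝ} (hp : 0 < p) :
    (p / (p + 1)) ^ (p + 1) ≤ (Real.exp 1)⁻¹ := by
  have h : 0 < p / (p + 1) := by positivity
  have hp1 : 0 < p + 1 := by linarith
  rw [← Real.exp_neg, Real.rpow_def_of_pos h, Real.exp_le_exp]
  have := Real.log_le_sub_one_of_pos h
  have h2 : p / (p + 1) - 1 = -1 / (p + 1) := by field_simp; ring
  rwa [h2, le_div_iff₀ hp1] at this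

/-- Removing from `A` the non-neighbours of a vertex of maximum degree inside `A` lowers the
clique number, and the removed vertices `B` have degree at most `|V| - |B|`. -/
theorem SimpleGraph.CliqueFreeOn.sum_degree_rpow_le {V : Type*} [Fintype V] [DecidableEq V]
    (G : SimpleGraph V) [DecidableRel G.Adj] {p : ℝ} (hp : 0 < p) (r : ℕ) (A : Finset V)
    (hA : G.CliqueFreeOn A (r + 1)) :
    ∑ u ∈ A, (G.degree u : ℝ) ^ p ≤
      r * (1 / p * (p / (p + 1)) ^ (p + 1) * (Fintype.card V : ℝ) ^ (p + 1)) := by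
  induction r generalizing A with
  | zero =>
    have : A = ∅ := by
      by_contra hne
      obtain ⟨a, ha⟩ := Finset.nonempty_iff_ne_empty.mpr hne
      exact hA (t := {a}) (by simpa using ha) (by simp [SimpleGraph.isNClique_iff])
    simp [this]
  | succ r ih =>
    rcases A.eq_empty_or_nonempty with rfl | hne
    · simp only [Finset.sum_empty]
      positivity
    obtain ⟨v, hv, hmax⟩ := A.exists_max_image (fun u => #(A ∩ G.neighborFinset u)) hne
    have hfree : G.CliqueFreeOn ((A ∩ G.neighborFinset v : Finset V) : Set V) (r + 1) := by
      simpa using SimpleGraph.CliqueFreeOn.of_succ G hA hv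
    have hrest := ih _ hfree
    have hdeg : ∀ u ∈ A \ (A ∩ G.neighborFinset v),
        (G.degree u : ℝ) ≤ Fintype.card V - #(A \ (A ∩ G.neighborFinset v)) := by
      intro u hu
      have h1 := hmax u (Finset.mem_sdiff.mp hu).1
      have h2 : G.degree u ≤ #(A ∩ G.neighborFinset u) + #(Aᶜ) := by
        rw [← G.card_neighborFinset_eq_degree]
        refine (Finset.card_le_card (t := (A ∩ G.neighborFinset u) ∪ Aᶜ) ?_).trans
          (Finset.card_union_le _ _)
        intro w hw
        by_cases hwA : w ∈ A <;> simp_all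
      have h3 := Finset.card_compl_add_card A
      have h4 := Finset.card_sdiff_add_card_eq_card
        (Finset.inter_subset_left : A ∩ G.neighborFinset v ⊆ A)
      have h5 : G.degree u + #(A \ (A ∩ G.neighborFinset v)) ≤ Fintype.card V := by
        omega
      rw [le_sub_iff_add_le]
      exact_mod_cast h5
    have hremoved : ∑ u ∈ A \ (A ∩ G.neighborFinset v), (G.degree u : ℝ) ^ p ≤
        1 / p * (p / (p + 1)) ^ (p + 1) * (Fintype.card V : ℝ) ^ (p + 1) := by
      calc _ ≤ ∑ u ∈ A \ (A ∩ G.neighborFinset v),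
            ((Fintype.card V : ℝ) - #(A \ (A ∩ G.neighborFinset v))) ^ p :=
            Finset.sum_le_sum fun u hu =>
              Real.rpow_le_rpow (Nat.cast_nonneg _) (hdeg u hu) hp.le
        _ = #(A \ (A ∩ G.neighborFinset v)) *
            ((Fintype.card V : ℝ) - #(A \ (A ∩ G.neighborFinset v))) ^ p := by
            rw [Finset.sum_const, nsmul_eq_mul]
        _ ≤ _ := mul_sub_rpow_le hp (Nat.cast_nonneg _) (by exact_mod_cast Finset.card_le_univ _)
    rw [← Finset.sum_sdiff (Finset.inter_subset_left : A ∩ G.neighborFinset v ⊆ A)]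
    push_cast
    linarith

theorem degPowerSum_le {n r : ℕ} {p : ℝ} (hp : 0 < p) (G : SimpleGraph (Fin n))
    (hG : G.CliqueFree (r + 1)) :
    degPowerSum p G ≤ (r : ℝ) / p * (p / (p + 1)) ^ (p + 1) * (n : ℝ) ^ (p + 1) := by
  classical
  have h := SimpleGraph.CliqueFreeOn.sum_degree_rpow_le G hp r Finset.univ
    (by simpa [SimpleGraph.cliqueFreeOn_univ] using hG)
  rw [Fintype.card_fin] at h
  calc degPowerSum p G = ∑ u, (G.degree u : ℝ) ^ p := by
        unfold degPowerSum; congr!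
    _ ≤ _ := h
    _ = _ := by ring

/-- The complete multipartite graph on `Fin n` with `s` consecutive parts of size `k`
and one part holding the remaining vertices. -/
def blockGraph (n s k : ℕ) : SimpleGraph (Fin n) :=
  (⊤ : SimpleGraph (Fin (s + 1))).comap
    fun i => ⟨min (i.val / k) s, by omega⟩

theorem blockGraph_cliqueFree (n s k : ℕ) : (blockGraph n s k).CliqueFree (s + 1 + 1) := by
  have hc : (blockGraph n s k).Colorable (s + 1) :=
    ⟨⟨fun i => ⟨min (i.val / k) s, by omega⟩, fun h => h⟩⟩
  exact hc.cliqueFree (Nat.lt_succ_self _)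

theorem blockGraph_adj {n s k : ℕ} (i j : Fin n) :
    (blockGraph n s k).Adj i j ↔ min (i.val / k) s ≠ min (j.val / k) s := by
  simp [blockGraph]

theorem le_degPowerSum_blockGraph {n s k : ℕ} {p : ℝ} (hp : 0 < p) (hk : 0 < k)
    (hn : s * k ≤ n) :
    (s * k : ℝ) * ((n : ℝ) - k) ^ p + ((n : ℝ) - s * k) * (s * k : ℝ) ^ p ≤
      degPowerSum p (blockGraph n s k) := by
  classical
  by_cases hkn : n < k
  · have hs : s = 0 := by nlinarith
    subst hs
    simp only [Nat.cast_zero, zero_mul, Real.zero_rpow hp.ne', mul_zero, add_zero]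
    exact Finset.sum_nonneg fun u _ => by positivity
  have hcard : #{u : Fin n | u.val < s * k} = s * k := by
    simp [Fin.card_filter_val_lt, hn]
  have hcard' : #{u : Fin n | ¬ u.val < s * k} = n - s * k := by
    have := Finset.card_filter_add_card_filter_not (s := (Finset.univ : Finset (Fin n)))
      (fun u => u.val < s * k)
    rw [Finset.card_univ, Fintype.card_fin] at this
    omega
  have hsmall : ∀ u : Fin n, u.val < s * k → n - k ≤ (blockGraph n s k).degree u := by
    intro u hu
    have hq : u.val / k < s := Nat.div_lt_of_lt_mul (by rwa [mul_comm])
    have h1 : #((blockGraph n s k).neighborFinset u)ᶜ ≤ k := by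
      calc _ ≤ #(Finset.Ico (u.val / k * k) (u.val / k * k + k)) := by
            refine Finset.card_le_card_of_injOn Fin.val ?_ (Fin.val_injective.injOn)
            intro w hw
            have hw' : min (u.val / k) s = min (w.val / k) s := by
              simpa [blockGraph_adj] using hw
            have hwq : w.val / k = u.val / k := by omega
            have h2 := Nat.div_add_mod w.val k
            have h3 := Nat.mod_lt w.val hk
            rw [hwq, mul_comm] at h2
            simp only [Finset.coe_Ico, Set.mem_Ico]
            omega
        _ = k := by simp
    have h2 := Finset.card_compl_add_card ((blockGraph n s k).neighborFinset u)
    rw [SimpleGraph.card_neighborFinset_eq_degree, Fintype.card_fin] at h2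
    omega
  have hlarge : ∀ u : Fin n, ¬ u.val < s * k → s * k ≤ (blockGraph n s k).degree u := by
    intro u hu
    have hq : s ≤ u.val / k := (Nat.le_div_iff_mul_le hk).mpr (by omega)
    rw [← hcard, ← SimpleGraph.card_neighborFinset_eq_degree]
    refine Finset.card_le_card fun w hw => ?_
    have hwq : w.val / k < s :=
      Nat.div_lt_of_lt_mul (by rw [mul_comm]; simpa using hw)
    rw [SimpleGraph.mem_neighborFinset, blockGraph_adj]
    omega
  have hsum : degPowerSum p (blockGraph n s k) =
      ∑ u, ((blockGraph n s k).degree u : ℝ) ^ p := by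
    unfold degPowerSum; congr!
  rw [hsum, ← Finset.sum_filter_add_sum_filter_not _ (fun u : Fin n => u.val < s * k)]
  refine add_le_add ?_ ?_
  · have h := Finset.card_nsmul_le_sum {u : Fin n | u.val < s * k}
      (fun u => ((blockGraph n s k).degree u : ℝ) ^ p) (((n : ℝ) - k) ^ p) fun u hu => by
        rw [← Nat.cast_sub (by omega)]
        exact Real.rpow_le_rpow (Nat.cast_nonneg _)
          (by exact_mod_cast hsmall u (Finset.mem_filter.mp hu).2) hp.le
    rw [hcard, nsmul_eq_mul] at h
    exact_mod_cast h
  · have h := Finset.card_nsmul_le_sum {u : Fin n | ¬ u.val < s * k}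
      (fun u => ((blockGraph n s k).degree u : ℝ) ^ p) ((s * k : ℝ) ^ p) fun u hu => by
        exact Real.rpow_le_rpow (by positivity)
          (by exact_mod_cast hlarge u (Finset.mem_filter.mp hu).2) hp.le
    rw [hcard', nsmul_eq_mul, Nat.cast_sub hn] at h
    exact_mod_cast h

/-- With `k = ⌊n / (p + 1)⌋`, the block graph beats `s / (p + 1) * (p / (p + 1)) ^ p * n ^ (p + 1)`
because the last part contributes a further positive proportion of `n ^ (p + 1)`. -/
theorem eventually_le_degPowerSum_blockGraph {s : ℕ} (hs : 0 < s) {p : ℝ} (hp : (s : ℝ) ≤ p) :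
    ∀ᶠ n : ℕ in Filter.atTop,
      (s : ℝ) / (p + 1) * (p / (p + 1)) ^ p * (n : ℝ) ^ (p + 1) ≤
        degPowerSum p (blockGraph n s ⌊1 / (p + 1) * (n : ℝ)⌋₊) := by
  have hs0 : (0 : ℝ) < s := by exact_mod_cast hs
  have hp0 : 0 < p := hs0.trans_le hp
  have hp1 : 0 < p + 1 := by linarith
  set g : ℝ → ℝ := fun y => s * y * (1 - y) ^ p + (1 - s * y) * (s * y) ^ p with hg
  have hgc : Continuous g := by
    have h1 : Continuous fun y : ℝ => (1 - y) ^ p :=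
      (continuous_const.sub continuous_id).rpow_const fun _ => Or.inr hp0.le
    have h2 : Continuous fun y : ℝ => (s * y) ^ p :=
      (continuous_const.mul continuous_id).rpow_const fun _ => Or.inr hp0.le
    fun_prop
  have hlim : Filter.Tendsto (fun n : ℕ => (⌊1 / (p + 1) * (n : ℝ)⌋₊ : ℝ) / n) Filter.atTop
      (nhds (1 / (p + 1))) :=
    (tendsto_nat_floor_mul_div_atTop (R := ℝ) (by positivity)).comp tendsto_natCast_atTop_atTop
  have hval : (s : ℝ) / (p + 1) * (p / (p + 1)) ^ p < g (1 / (p + 1)) := by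
    have h1 : 1 - 1 / (p + 1) = p / (p + 1) := by field_simp; ring
    have h2 : 0 < 1 - s * (1 / (p + 1)) := by
      rw [mul_one_div, sub_pos, div_lt_one hp1]
      linarith
    have h3 : 0 < (1 - s * (1 / (p + 1))) * (s * (1 / (p + 1))) ^ p := by positivity
    simp only [hg, h1]
    rw [mul_one_div] at h3 ⊢
    linarith
  filter_upwards [((hgc.tendsto _).comp hlim).eventually (lt_mem_nhds hval),
    hlim.eventually (lt_mem_nhds (by positivity : (0 : ℝ) < 1 / (p + 1))),
    Filter.eventually_gt_atTop 0] with n hgn hkn hn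
  simp only [Function.comp] at hgn
  have hn0 : (0 : ℝ) < n := by exact_mod_cast hn
  have hfloor : (⌊1 / (p + 1) * (n : ℝ)⌋₊ : ℝ) ≤ 1 / (p + 1) * n := Nat.floor_le (by positivity)
  set k := ⌊1 / (p + 1) * (n : ℝ)⌋₊
  have hk : 0 < k := by
    rw [div_pos_iff_of_pos_right hn0] at hkn
    exact_mod_cast hkn
  have hle : (k : ℝ) ≤ n := hfloor.trans <| by
    rw [one_div_mul_eq_div, div_le_iff₀ hp1]
    nlinarith
  have hskn : s * k ≤ n := by
    have : (s : ℝ) * k ≤ n := by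
      calc (s : ℝ) * k ≤ s * (1 / (p + 1) * n) := by gcongr
        _ = s * n / (p + 1) := by ring
        _ ≤ n := by
          rw [div_le_iff₀ hp1]
          nlinarith
    exact_mod_cast this
  refine le_trans ?_ (le_degPowerSum_blockGraph hp0 hk hskn)
  have hscale : g (k / n) * (n : ℝ) ^ (p + 1) =
      (s * k : ℝ) * ((n : ℝ) - k) ^ p + ((n : ℝ) - s * k) * (s * k : ℝ) ^ p := by
    have h1 : (1 - (k : ℝ) / n) = (n - k) / n := by field_simp
    have h2 : (s : ℝ) * (k / n) = s * k / n := by ring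
    simp only [hg]
    rw [h1, h2, Real.div_rpow (by linarith) hn0.le, Real.div_rpow (by positivity) hn0.le,
      Real.rpow_add_one hn0.ne']
    have := (Real.rpow_pos_of_pos hn0 p).ne'
    field_simp
  rw [← hscale]
  gcongr

theorem stmt9 (r : ℕ) (hr : 2 ≤ r) (p : ℝ) (hp : (r : ℝ) ≤ p) :
    ∃ N : ℕ, ∀ n : ℕ, N ≤ n →
      (((r : ℝ) - 1) / ((p + 1) * Real.exp 1)) * (n : ℝ) ^ (p + 1) ≤
        (((r : ℝ) - 1) / (p + 1)) * (p / (p + 1)) ^ p * (n : ℝ) ^ (p + 1) ∧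
      (((r : ℝ) - 1) / (p + 1)) * (p / (p + 1)) ^ p * (n : ℝ) ^ (p + 1) ≤
        phiClique r p n ∧
      phiClique r p n ≤ ((r : ℝ) / p) * (p / (p + 1)) ^ (p + 1) * (n : ℝ) ^ (p + 1) ∧
      ((r : ℝ) / p) * (p / (p + 1)) ^ (p + 1) * (n : ℝ) ^ (p + 1) ≤
        ((r : ℝ) / (p * Real.exp 1)) * (n : ℝ) ^ (p + 1) := by
  obtain ⟨s, rfl⟩ : ∃ s, r = s + 1 := ⟨r - 1, by omega⟩
  have hs : 0 < s := by omega
  have hsp : (s : ℝ) ≤ p := by push_cast at hp; linarith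
  have hp0 : 0 < p := lt_of_lt_of_le (by exact_mod_cast hs) hsp
  obtain ⟨N, hN⟩ := Filter.eventually_atTop.mp (eventually_le_degPowerSum_blockGraph hs hsp)
  have hs1 : ((s + 1 : ℕ) : ℝ) - 1 = s := by push_cast; ring
  refine ⟨N, fun n hn => ⟨?_, ?_, ?_, ?_⟩⟩
  · rw [hs1, ← div_div, div_eq_mul_inv _ (Real.exp 1)]
    gcongr
    exact exp_neg_one_le_div_add_one_rpow hp0
  · rw [hs1]
    refine (hN n hn).trans (le_csSup
      ⟨(s + 1 : ℕ) / p * (p / (p + 1)) ^ (p + 1) * (n : ℝ) ^ (p + 1), ?_⟩ ⟨_, blockGraph_cliqueFree _ _ _, rfl⟩)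
    rintro x ⟨G, hG, rfl⟩
    exact degPowerSum_le hp0 G hG
  · refine csSup_le ⟨_, _, blockGraph_cliqueFree n s 0, rfl⟩ ?_
    rintro x ⟨G, hG, rfl⟩
    exact degPowerSum_le hp0 G hG
  · rw [← div_div _ p, div_eq_mul_inv _ (Real.exp 1)]
    gcongr
    exact div_add_one_rpow_add_one_le hp0
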